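/- Let X and A be finite nonempty sets, γ ∈ [0,1), and R_max ≥ 0. For each a ∈ A let r^a ∈ ℝ^X satisfy 0 ≤ r^a(x) ≤ R_max for all x, and let P^a be a row-stochastic X×X matrix. Let π : X × A → [0,1] be a stationary policy, i.e., ∑_{a∈A} π(x,a) = 1 and π(x,a) ≥ 0 for all x. Let M be an X×X real matrix whose ℓ∞ operator norm (maximum absolute row sum) is at most 1. Suppose v^π ∈ ℝ^X satisfies the exact policy-evaluation equations v^π(x) = ∑_{a∈A} π(x,a)·( r^a(x) + γ·(P^a v^π)(x) ) for all x, and ṽ ∈ ℝ^X satisfies the approximate equations ṽ = M·( ∑_{a∈A} π(·,a)·( r^a + γ·P^a ṽ ) ). Then ‖v^π‖∞ ≤ R_max/(1−γ), ‖ṽ − v^π‖∞ ≤ 2·R_max/(1−γ)², and ‖ṽ‖∞ ≤ ((3−γ)/(1−γ)) · R_max/(1−γ). -/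

import Mathlib

open Finset

/-- The max-norm `‖v‖∞ = max_x |v x|` of a vector over a finite nonempty index set. -/
noncomputable def maxNorm {X : Type*} [Fintype X] [Nonempty X] (v : X → ℝ) : ℝ :=
  Finset.univ.sup' Finset.univ_nonempty fun x => |v x|

theorem abs_le_maxNorm {X : Type*} [Fintype X] [Nonempty X] (v : X → ℝ) (x : X) :
    |v x| ≤ maxNorm v :=
  Finset.le_sup' (fun x => |v x|) (Finset.mem_univ x)

theorem maxNorm_le {X : Type*} [Fintype X] [Nonempty X] {v : X → ℝ} {c : ℝ}
    (h : ∀ x, |v x| ≤ c) : maxNorm v ≤ c :=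
  Finset.sup'_le _ _ fun x _ => h x

theorem maxNorm_nonneg {X : Type*} [Fintype X] [Nonempty X] (v : X → ℝ) : 0 ≤ maxNorm v :=
  (abs_nonneg _).trans (abs_le_maxNorm v (Classical.arbitrary X))

theorem abs_sum_mul_le {ι : Type*} [Fintype ι] {w f : ι → ℝ} {c : ℝ} (hc : 0 ≤ c)
    (hw : ∑ i, |w i| ≤ 1) (hf : ∀ i, |f i| ≤ c) : |∑ i, w i * f i| ≤ c :=
  calc |∑ i, w i * f i| ≤ ∑ i, |w i * f i| := Finset.abs_sum_le_sum_abs _ _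
    _ ≤ ∑ i, |w i| * c := Finset.sum_le_sum fun i _ => by
        rw [abs_mul]; exact mul_le_mul_of_nonneg_left (hf i) (abs_nonneg _)
    _ = (∑ i, |w i|) * c := (Finset.sum_mul _ _ _).symm
    _ ≤ c := mul_le_of_le_one_left hc hw

/-- The Bellman operator of a policy maps `v` into the max-norm ball of radius
`Rmax + γ * maxNorm v`. -/
theorem abs_bellman_le {X A : Type*} [Fintype X] [Nonempty X] [Fintype A]
    {γ Rmax : ℝ} (hγ0 : 0 ≤ γ) (hR : 0 ≤ Rmax)
    {r : A → X → ℝ} (hr : ∀ a x, 0 ≤ r a x ∧ r a x ≤ Rmax)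
    {P : A → Matrix X X ℝ}
    (hP0 : ∀ a x y, 0 ≤ P a x y) (hP1 : ∀ a x, ∑ y, P a x y = 1)
    {π : X → A → ℝ} (hπ0 : ∀ x a, 0 ≤ π x a) (hπ1 : ∀ x, ∑ a, π x a = 1)
    (v : X → ℝ) (x : X) :
    |∑ a, π x a * (r a x + γ * (P a).mulVec v x)| ≤ Rmax + γ * maxNorm v := by
  have hv := maxNorm_nonneg v
  refine abs_sum_mul_le (by positivity) ?_ fun a => ?_
  · simp only [abs_of_nonneg (hπ0 x _), hπ1, le_refl]
  · have hPv : |(P a).mulVec v x| ≤ maxNorm v := by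
      refine abs_sum_mul_le hv ?_ (abs_le_maxNorm v)
      simp only [abs_of_nonneg (hP0 a x _), hP1, le_refl]
    refine (abs_add_le _ _).trans (add_le_add ?_ ?_)
    · rw [abs_of_nonneg (hr a x).1]; exact (hr a x).2
    · rw [abs_mul, abs_of_nonneg hγ0]; exact mul_le_mul_of_nonneg_left hPv hγ0

theorem maxNorm_le_div_one_sub {X : Type*} [Fintype X] [Nonempty X] {γ c : ℝ} (hγ1 : γ < 1)
    {v : X → ℝ} (h : ∀ x, |v x| ≤ c + γ * maxNorm v) : maxNorm v ≤ c / (1 - γ) := by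
  rw [le_div_iff₀ (sub_pos.2 hγ1)]
  linarith [maxNorm_le h]

/-- bounds for exact and approximate policy-evaluation fixed points:
with rewards in `[0, R_max]`, the exact policy value satisfies `‖v^π‖∞ ≤ R_max/(1−γ)`,
the approximate fixed point `ṽ` satisfies `‖ṽ − v^π‖∞ ≤ 2 R_max/(1−γ)²`, and hence
`‖ṽ‖∞ ≤ ((3−γ)/(1−γ)) · R_max/(1−γ)`. -/
theorem policy_value_bounds
    {X A : Type*} [Fintype X] [Nonempty X] [Fintype A] [Nonempty A]
    (γ Rmax : ℝ) (hγ0 : 0 ≤ γ) (hγ1 : γ < 1) (hR : 0 ≤ Rmax)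
    (r : A → X → ℝ) (hr : ∀ a x, 0 ≤ r a x ∧ r a x ≤ Rmax)
    (P : A → Matrix X X ℝ)
    (hP0 : ∀ a x y, 0 ≤ P a x y) (hP1 : ∀ a x, ∑ y, P a x y = 1)
    (π : X → A → ℝ) (hπ0 : ∀ x a, 0 ≤ π x a) (hπ1 : ∀ x, ∑ a, π x a = 1)
    (M : Matrix X X ℝ) (hM : ∀ x, ∑ y, |M x y| ≤ 1)
    (vπ : X → ℝ)
    (hvπ : ∀ x, vπ x = ∑ a, π x a * (r a x + γ * (P a).mulVec vπ x))
    (vt : X → ℝ)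
    (hvt : vt = M.mulVec fun x => ∑ a, π x a * (r a x + γ * (P a).mulVec vt x)) :
    maxNorm vπ ≤ Rmax / (1 - γ) ∧
    maxNorm (vt - vπ) ≤ 2 * Rmax / (1 - γ) ^ 2 ∧
    maxNorm vt ≤ ((3 - γ) / (1 - γ)) * (Rmax / (1 - γ)) := by
  have hT := abs_bellman_le hγ0 hR hr hP0 hP1 hπ0 hπ1
  have hγ : 0 < 1 - γ := sub_pos.2 hγ1
  have h1 : maxNorm vπ ≤ Rmax / (1 - γ) :=
    maxNorm_le_div_one_sub hγ1 fun x => (congrArg abs (hvπ x)).trans_le (hT vπ x)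
  have h2 : maxNorm vt ≤ Rmax / (1 - γ) := by
    refine maxNorm_le_div_one_sub hγ1 fun x => (congrArg abs (congrFun hvt x)).trans_le ?_
    have hv := maxNorm_nonneg vt
    exact abs_sum_mul_le (by positivity) (hM x) (hT vt)
  have hB : 0 ≤ Rmax / (1 - γ) := div_nonneg hR hγ.le
  refine ⟨h1, ?_, h2.trans (le_mul_of_one_le_left hB ?_)⟩
  · calc maxNorm (vt - vπ) ≤ 2 * (Rmax / (1 - γ)) := maxNorm_le fun x => by
          have := abs_sub (vt x) (vπ x)
          rw [Pi.sub_apply]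
          linarith [abs_le_maxNorm vt x, abs_le_maxNorm vπ x]
      _ ≤ 2 * (Rmax / (1 - γ)) / (1 - γ) :=
          le_div_self (by positivity) hγ (by linarith)
      _ = 2 * Rmax / (1 - γ) ^ 2 := by field_simp
  · rw [one_le_div hγ]
    linarith
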